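/- For all g ∈ H and h ∈ H_rel, τ'(g ∘ h) = τ'(g) + Cal(h) and τ'(h ∘ g) = τ'(g) + Cal(h), where Cal is the Calabi invariant. -/

import Mathlib

open MeasureTheory

noncomputable section

/-- The closed unit disk in `ℝ²`. -/
def Disk : Set (ℝ × ℝ) := {p | p.1 ^ 2 + p.2 ^ 2 ≤ 1}

/-- The boundary circle `∂D` of the unit disk. -/
def Bdry : Set (ℝ × ℝ) := {p | p.1 ^ 2 + p.2 ^ 2 = 1}

/-- A symplectomorphism of the closed unit disk `D`: a bijection of `D` which, together
with its inverse, extends to a `C^∞` map on an open neighborhood of `D`, and whose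
Jacobian determinant equals `1` at every point of `D`. -/
structure SympD where
  toFun : ℝ × ℝ → ℝ × ℝ
  invFun : ℝ × ℝ → ℝ × ℝ
  mapsTo : Set.MapsTo toFun Disk Disk
  invMapsTo : Set.MapsTo invFun Disk Disk
  leftInv : ∀ p ∈ Disk, invFun (toFun p) = p
  rightInv : ∀ p ∈ Disk, toFun (invFun p) = p
  smooth : ∃ U : Set (ℝ × ℝ), IsOpen U ∧ Disk ⊆ U ∧ ContDiffOn ℝ (⊤ : ℕ∞) toFun U
  invSmooth : ∃ U : Set (ℝ × ℝ), IsOpen U ∧ Disk ⊆ U ∧ ContDiffOn ℝ (⊤ : ℕ∞) invFun U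
  areaPreserving : ∀ p ∈ Disk,
    (fderiv ℝ toFun p (1, 0)).1 * (fderiv ℝ toFun p (0, 1)).2
      - (fderiv ℝ toFun p (0, 1)).1 * (fderiv ℝ toFun p (1, 0)).2 = 1

/-- `g ∈ H_rel`: the restriction of `g` to the boundary circle is the identity. -/
def IsRel (g : SympD) : Prop := ∀ p ∈ Bdry, g.toFun p = p

/-- `g ∈ G`: `g` fixes the origin. -/
def FixesOrigin (g : SympD) : Prop := g.toFun (0, 0) = (0, 0)

/-- `g ∈ G_rel = G ∩ H_rel`. -/
def IsGrel (g : SympD) : Prop := FixesOrigin g ∧ IsRel g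

/-- `gh` coincides on `D` with the composite `g ∘ h`. -/
def IsComp (g h gh : SympD) : Prop := ∀ p ∈ Disk, gh.toFun p = g.toFun (h.toFun p)

/-- The 1-cochain `τ(g) = ∫_γ (g*η − η) = ∫₀¹ ½(g₁ ∂₁g₂ − g₂ ∂₁g₁)(t,0) dt`,
where `γ(t) = (t,0)` and `η = (x dy − y dx)/2` vanishes along `γ`. -/
def tau (g : SympD) : ℝ :=
  ∫ t in (0:ℝ)..1, (1 / 2) *
    ((g.toFun (t, 0)).1 * (fderiv ℝ g.toFun (t, 0) (1, 0)).2
      - (g.toFun (t, 0)).2 * (fderiv ℝ g.toFun (t, 0) (1, 0)).1)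

/-- `φ : ℝ → ℝ` is a lift of the boundary restriction `g|_{∂D}`. -/
def IsLift (g : SympD) (φ : ℝ → ℝ) : Prop :=
  ContDiff ℝ (⊤ : ℕ∞) φ ∧ (∀ θ : ℝ, φ (θ + 2 * Real.pi) = φ θ + 2 * Real.pi) ∧
    ∀ θ : ℝ, g.toFun (Real.cos θ, Real.sin θ) = (Real.cos (φ θ), Real.sin (φ θ))

/-- `F` is the primitive `F_g` of the closed 1-form `g*η − η` on `D`, normalized by
`F(x₀) = 0` at `x₀ = (1,0)`: it is `C^∞` on a neighborhood of `D` and satisfies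
`dF = g*η − η` at every point of `D`. -/
def IsPrimitive (g : SympD) (F : ℝ × ℝ → ℝ) : Prop :=
  (∃ U : Set (ℝ × ℝ), IsOpen U ∧ Disk ⊆ U ∧ ContDiffOn ℝ (⊤ : ℕ∞) F U) ∧
  (∀ p ∈ Disk, ∀ v : ℝ × ℝ,
    fderiv ℝ F p v =
      (1 / 2) * ((g.toFun p).1 * (fderiv ℝ g.toFun p v).2
        - (g.toFun p).2 * (fderiv ℝ g.toFun p v).1)
      - (1 / 2) * (p.1 * v.2 - p.2 * v.1)) ∧
  F (1, 0) = 0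

/-- `κ(g) = −∫_{∂D} F_g η = −½ ∫₀^{2π} F_g(cos θ, sin θ) dθ`, expressed in terms of a
chosen primitive `F = F_g`. -/
def kappaOf (F : ℝ × ℝ → ℝ) : ℝ :=
  -(1 / 2) * ∫ θ in (0:ℝ)..(2 * Real.pi), F (Real.cos θ, Real.sin θ)

/-- The 1-cochain `τ₀(g) = ∫_D g*η ∧ η
 = ∬_D ¼[(g₁ ∂ₓg₂ − g₂ ∂ₓg₁)x + (g₁ ∂_yg₂ − g₂ ∂_yg₁)y] dx dy`. -/
def tau0 (g : SympD) : ℝ :=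
  ∫ p in Disk, (1 / 4) *
    (((g.toFun p).1 * (fderiv ℝ g.toFun p (1, 0)).2
        - (g.toFun p).2 * (fderiv ℝ g.toFun p (1, 0)).1) * p.1
      + ((g.toFun p).1 * (fderiv ℝ g.toFun p (0, 1)).2
        - (g.toFun p).2 * (fderiv ℝ g.toFun p (0, 1)).1) * p.2)

lemma disk_closed : IsClosed Disk := by
  unfold Disk
  exact isClosed_le (by fun_prop) (by fun_prop)

lemma disk_compact : IsCompact Disk := by
  refine (isCompact_Icc (a := ((-1:ℝ), (-1:ℝ))) (b := ((1:ℝ), (1:ℝ)))).of_isClosed_subset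
    disk_closed ?_
  rintro ⟨x, y⟩ h
  simp only [Disk, Set.mem_ofPred_eq] at h
  simp only [Set.mem_Icc, Prod.mk_le_mk]
  refine ⟨⟨?_, ?_⟩, ?_, ?_⟩ <;> nlinarith [sq_nonneg x, sq_nonneg y]

lemma disk_convex : Convex ℝ Disk := by
  rintro ⟨x, y⟩ h ⟨u, v⟩ h' a b ha hb hab
  simp only [Disk, Set.mem_ofPred_eq] at *
  simp only [Prod.smul_mk, Prod.mk_add_mk, smul_eq_mul]
  have hb' : b = 1 - a := by linarith
  have h1 : (a * x + b * u)^2 + (a * y + b * v)^2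
      = a * (x^2+y^2) + b * (u^2+v^2) - a * b * ((x-u)^2 + (y-v)^2) := by
    subst hb'; ring
  rw [h1]
  nlinarith [mul_nonneg (mul_nonneg ha hb) (add_nonneg (sq_nonneg (x-u)) (sq_nonneg (y-v))),
    mul_le_mul_of_nonneg_left h ha, mul_le_mul_of_nonneg_left h' hb]

lemma disk_nhds {p : ℝ × ℝ} (h : p.1 ^ 2 + p.2 ^ 2 < 1) : Disk ∈ nhds p := by
  have : IsOpen {p : ℝ × ℝ | p.1 ^ 2 + p.2 ^ 2 < 1} :=
    isOpen_lt (by fun_prop) (by fun_prop)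
  exact Filter.mem_of_superset (this.mem_nhds h) (fun q hq => le_of_lt (a := q.1 ^ 2 + q.2 ^ 2) hq)

lemma disk_uniqueDiff : UniqueDiffOn ℝ Disk :=
  uniqueDiffOn_convex disk_convex
    ⟨0, mem_interior_iff_mem_nhds.2 (disk_nhds (by norm_num))⟩

lemma SympD.contDiffAt (g : SympD) {p : ℝ × ℝ} (hp : p ∈ Disk) :
    ContDiffAt ℝ (⊤ : ℕ∞) g.toFun p := by
  obtain ⟨U, hU, hD, h⟩ := g.smooth
  exact h.contDiffAt (hU.mem_nhds (hD hp))

lemma SympD.diffAt (g : SympD) {p : ℝ × ℝ} (hp : p ∈ Disk) :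
    DifferentiableAt ℝ g.toFun p := (g.contDiffAt hp).differentiableAt (by simp)

lemma fderiv_eq_of_disk {f k : ℝ × ℝ → ℝ × ℝ} {p : ℝ × ℝ} (hp : p ∈ Disk)
    (hf : DifferentiableAt ℝ f p) (hk : DifferentiableAt ℝ k p)
    (h : ∀ q ∈ Disk, f q = k q) : fderiv ℝ f p = fderiv ℝ k p := by
  rw [← hf.fderivWithin (disk_uniqueDiff p hp), ← hk.fderivWithin (disk_uniqueDiff p hp)]
  exact fderivWithin_congr h (h p hp)

lemma comp_fderiv {g h gh : SympD} (hc : IsComp g h gh) {p : ℝ × ℝ} (hp : p ∈ Disk) (v : ℝ × ℝ) :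
    fderiv ℝ gh.toFun p v = fderiv ℝ g.toFun (h.toFun p) (fderiv ℝ h.toFun p v) := by
  have h1 := g.diffAt (h.mapsTo hp)
  have h2 := h.diffAt hp
  rw [fderiv_eq_of_disk hp (gh.diffAt hp) (h1.comp p h2) hc, fderiv_comp p h1 h2]
  rfl

lemma det_formula (A : ℝ × ℝ →L[ℝ] ℝ × ℝ) :
    A.det = (A (1, 0)).1 * (A (0, 1)).2 - (A (0, 1)).1 * (A (1, 0)).2 := by
  rw [ContinuousLinearMap.det, ← LinearMap.det_toMatrix (Module.Basis.finTwoProd ℝ),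
    Matrix.det_fin_two]
  simp [LinearMap.toMatrix_apply]

lemma integral_comp_symp (g : SympD) (F : ℝ × ℝ → ℝ) :
    ∫ p in Disk, F (g.toFun p) = ∫ p in Disk, F p := by
  have him : g.toFun '' Disk = Disk := by
    apply Set.Subset.antisymm
    · exact g.mapsTo.image_subset
    · intro q hq
      exact ⟨g.invFun q, g.invMapsTo hq, g.rightInv q hq⟩
  have hinj : Set.InjOn g.toFun Disk := by
    intro p hp q hq h
    rw [← g.leftInv p hp, ← g.leftInv q hq, h]
  have := integral_image_eq_integral_abs_det_fderiv_smul volume disk_closed.measurableSet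
    (fun p hp => (g.diffAt hp).hasFDerivAt.hasFDerivWithinAt) hinj F
  rw [him] at this
  rw [this]
  apply setIntegral_congr_fun disk_closed.measurableSet
  intro p hp
  simp only [det_formula, g.areaPreserving p hp]
  simp

lemma bdry_mapsTo (g : SympD) {p : ℝ × ℝ} (hp : p ∈ Bdry) : g.toFun p ∈ Bdry := by
  have hpD : p ∈ Disk := le_of_eq hp
  have hqD := g.mapsTo hpD
  by_contra hne
  have hlt : (g.toFun p).1 ^ 2 + (g.toFun p).2 ^ 2 < 1 := lt_of_le_of_ne hqD hne
  set q := g.toFun p with hq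
  have hip : g.invFun q = p := g.leftInv p hpD
  obtain ⟨U, hU, hUD, hsm⟩ := g.invSmooth
  have hca : ContDiffAt ℝ (⊤ : ℕ∞) g.invFun q := hsm.contDiffAt (hU.mem_nhds (hUD hqD))
  have hs := hca.hasStrictFDerivAt (by simp)
  set A := fderiv ℝ g.invFun q
  have hcomp : HasFDerivAt (g.toFun ∘ g.invFun) ((fderiv ℝ g.toFun p).comp A) q := by
    apply HasFDerivAt.comp q _ hs.hasFDerivAt
    rw [hip]
    exact (g.diffAt hpD).hasFDerivAt
  have hid : HasFDerivAt (g.toFun ∘ g.invFun) (ContinuousLinearMap.id ℝ (ℝ × ℝ)) q := by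
    apply (hasFDerivAt_id q).congr_of_eventuallyEq
    filter_upwards [disk_nhds hlt] with r hr
    exact g.rightInv r hr
  have heq := hcomp.unique hid
  have hinj : Function.Injective A := by
    intro u v huv
    have h1 := DFunLike.congr_fun heq u
    have h2 := DFunLike.congr_fun heq v
    simp only [ContinuousLinearMap.comp_apply, ContinuousLinearMap.id_apply] at h1 h2
    rw [← h1, ← h2, huv]
  have hsurj : Function.Surjective A :=
    LinearMap.surjective_of_injective (f := (A : ℝ × ℝ →ₗ[ℝ] ℝ × ℝ)) hinj
  have hmap := HasStrictFDerivAt.map_nhds_eq_of_surj hs (LinearMap.range_eq_top.2 hsurj)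
  rw [hip] at hmap
  have hDp : Disk ∈ nhds p := by
    rw [← hmap, Filter.mem_map]
    exact Filter.mem_of_superset (disk_nhds hlt) g.invMapsTo
  have hcont : Filter.Tendsto (fun t : ℝ => t • p) (nhds 1) (nhds p) := by
    have : ContinuousAt (fun t : ℝ => t • p) 1 := by fun_prop
    simpa [ContinuousAt] using this
  obtain ⟨ε, hε, hball⟩ := Metric.mem_nhds_iff.1 (hcont hDp)
  have : (1 + ε / 2 : ℝ) ∈ Metric.ball (1:ℝ) ε := by
    rw [Metric.mem_ball, Real.dist_eq]
    rw [abs_lt]; constructor <;> linarith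
  have := hball this
  simp only [Disk, Bdry, Set.mem_preimage, Set.mem_ofPred_eq, Prod.smul_fst, Prod.smul_snd,
    smul_eq_mul] at this hp
  have h3 : (1 + ε/2)^2 * (p.1^2+p.2^2) ≤ 1 := by nlinarith
  rw [hp] at h3
  nlinarith

lemma stokes_disk (F : ℝ × ℝ → ℝ) (U : Set (ℝ × ℝ)) (hU : IsOpen U) (hUD : Disk ⊆ U)
    (hF : ContDiffOn ℝ (⊤ : ℕ∞) F U) :
    ∫ p in Disk, ((1 / 2) * fderiv ℝ F p p + F p) =
      (1 / 2) * ∫ θ in (0:ℝ)..(2 * Real.pi), F (Real.cos θ, Real.sin θ) := by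
  have hdc : ContinuousOn (fun p => fderiv ℝ F p) U :=
    hF.continuousOn_fderiv_of_isOpen hU (by simp)
  have hGc : ContinuousOn (fun p => (1 / 2) * fderiv ℝ F p p + F p) Disk := by
    have h1 := hdc.mono hUD
    have h2 := hF.continuousOn.mono hUD
    fun_prop
  set G : ℝ × ℝ → ℝ := fun p => (1 / 2) * fderiv ℝ F p p + F p with hG
  have hmem : ∀ r θ : ℝ, 0 ≤ r → r ≤ 1 → (r * Real.cos θ, r * Real.sin θ) ∈ Disk := by
    intro r θ h0 h1
    simp only [Disk, Set.mem_ofPred_eq]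
    have := Real.sin_sq_add_cos_sq θ
    have : (r * Real.cos θ)^2 + (r * Real.sin θ)^2 = r^2 := by
      linear_combination r^2 * this
    rw [this]; nlinarith
  have hKc : ContinuousOn (fun z : ℝ × ℝ => z.1 * G (z.1 * Real.cos z.2, z.1 * Real.sin z.2))
      (Set.Icc 0 1 ×ˢ Set.Icc (-Real.pi) Real.pi) := by
    apply ContinuousOn.mul (by fun_prop)
    apply ContinuousOn.comp (t := Disk) hGc (by fun_prop)
    rintro ⟨r, θ⟩ ⟨hr, -⟩
    exact hmem r θ hr.1 hr.2
  have hKi : IntegrableOn (fun z : ℝ × ℝ => z.1 * G (z.1 * Real.cos z.2, z.1 * Real.sin z.2))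
      (Set.Ioc 0 1 ×ˢ Set.Ioo (-Real.pi) Real.pi) (volume.prod volume) := by
    refine IntegrableOn.mono_set ?_ (Set.prod_mono Set.Ioc_subset_Icc_self Set.Ioo_subset_Icc_self)
    exact hKc.integrableOn_compact (isCompact_Icc.prod isCompact_Icc)
  have hinner : ∀ θ : ℝ, ∫ r in Set.Ioc (0:ℝ) 1, r * G (r * Real.cos θ, r * Real.sin θ)
      = (1 / 2) * F (Real.cos θ, Real.sin θ) := by
    intro θ
    rw [← intervalIntegral.integral_of_le zero_le_one]
    have hd : ∀ r ∈ Set.uIcc (0:ℝ) 1, HasDerivAt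
        (fun r : ℝ => (1 / 2) * (r ^ 2 * F (r * Real.cos θ, r * Real.sin θ)))
        (r * G (r * Real.cos θ, r * Real.sin θ)) r := by
      intro r hr
      rw [Set.uIcc_of_le zero_le_one] at hr
      have hm := hmem r θ hr.1 hr.2
      have hFd : HasFDerivAt F (fderiv ℝ F (r * Real.cos θ, r * Real.sin θ))
          (r * Real.cos θ, r * Real.sin θ) :=
        ((hF.contDiffAt (hU.mem_nhds (hUD hm))).differentiableAt (by simp)).hasFDerivAt
      have hc : HasDerivAt (fun r : ℝ => (r * Real.cos θ, r * Real.sin θ))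
          (Real.cos θ, Real.sin θ) r := by
        have := ((hasDerivAt_id r).mul_const (Real.cos θ)).prodMk
          ((hasDerivAt_id r).mul_const (Real.sin θ))
        simpa using this
      have h1 := hFd.comp_hasDerivAt r hc
      have h2 := (((hasDerivAt_id r).pow 2).mul h1).const_mul (1 / 2 : ℝ)
      refine HasDerivAt.congr_deriv h2 ?_
      have h3 : ((r * Real.cos θ, r * Real.sin θ) : ℝ × ℝ) = r • (Real.cos θ, Real.sin θ) := by
        simp
      have h4 : fderiv ℝ F (r * Real.cos θ, r * Real.sin θ) (r * Real.cos θ, r * Real.sin θ)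
          = r * fderiv ℝ F (r * Real.cos θ, r * Real.sin θ) (Real.cos θ, Real.sin θ) := by
        conv_lhs => arg 2; rw [h3]
        rw [map_smul, smul_eq_mul]
      simp only [hG, h4, Function.comp, id]
      simp
      ring
    rw [intervalIntegral.integral_eq_sub_of_hasDerivAt hd]
    · simp
    · apply ContinuousOn.intervalIntegrable
      rw [Set.uIcc_of_le zero_le_one]
      apply ContinuousOn.mul (by fun_prop)
      apply ContinuousOn.comp (t := Disk) hGc (by fun_prop)
      intro r hr
      exact hmem r θ hr.1 hr.2
  rw [← integral_indicator disk_closed.measurableSet, ← integral_comp_polarCoord_symm]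
  have hset : ∫ z in polarCoord.target, z.1 • Disk.indicator G (polarCoord.symm z)
      = ∫ z in Set.Ioc (0:ℝ) 1 ×ˢ Set.Ioo (-Real.pi) Real.pi,
        z.1 * G (z.1 * Real.cos z.2, z.1 * Real.sin z.2) := by
    have hms : MeasurableSet (Set.Ioc (0:ℝ) 1 ×ˢ Set.Ioo (-Real.pi) Real.pi) :=
      measurableSet_Ioc.prod measurableSet_Ioo
    have hsub : (Set.Ioc (0:ℝ) 1 ×ˢ Set.Ioo (-Real.pi) Real.pi) =
        polarCoord.target ∩ (Set.Ioc (0:ℝ) 1 ×ˢ Set.Ioo (-Real.pi) Real.pi) := by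
      rw [polarCoord_target]
      symm
      apply Set.inter_eq_right.2
      exact Set.prod_mono Set.Ioc_subset_Ioi_self le_rfl
    rw [hsub, ← setIntegral_indicator hms]
    apply setIntegral_congr_fun polarCoord.open_target.measurableSet
    rintro ⟨r, θ⟩ hz
    rw [polarCoord_target] at hz
    obtain ⟨hr, hθ⟩ := hz
    have hr : 0 < r := hr
    simp only [polarCoord_symm_apply, smul_eq_mul]
    by_cases h1 : r ≤ 1
    · rw [Set.indicator_of_mem (hmem r θ hr.le h1), Set.indicator_of_mem]
      exact ⟨⟨hr, h1⟩, hθ⟩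
    · rw [Set.indicator_of_notMem, Set.indicator_of_notMem, mul_zero]
      · rintro ⟨⟨-, h⟩, -⟩
        exact h1 h
      · intro h
        simp only [Disk, Set.mem_ofPred_eq] at h
        have := Real.sin_sq_add_cos_sq θ
        have : (r * Real.cos θ)^2 + (r * Real.sin θ)^2 = r^2 := by
          linear_combination r^2 * this
        rw [this] at h
        nlinarith
  rw [hset, Measure.volume_eq_prod, setIntegral_prod _ hKi, integral_integral_swap]
  · simp only [hinner]
    rw [integral_const_mul]
    congr 1
    rw [← integral_Ioc_eq_integral_Ioo,
      ← intervalIntegral.integral_of_le (by linarith [Real.pi_pos])]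
    have hper : Function.Periodic (fun θ : ℝ => F (Real.cos θ, Real.sin θ)) (2 * Real.pi) := by
      intro θ
      simp
    have := hper.intervalIntegral_add_eq (-Real.pi) 0
    rw [show -Real.pi + 2 * Real.pi = Real.pi by ring, zero_add] at this
    exact this
  · rw [Measure.prod_restrict]
    exact hKi

lemma tau'_eq {g : SympD} {F : ℝ × ℝ → ℝ} (hF : IsPrimitive g F) :
    tau0 g + kappaOf F = - ∫ p in Disk, F p := by
  obtain ⟨⟨U, hU, hUD, hs⟩, hd, -⟩ := hF
  have h1 := stokes_disk F U hU hUD hs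
  have hdc : ContinuousOn (fun p => fderiv ℝ F p) Disk :=
    (hs.continuousOn_fderiv_of_isOpen hU (by simp)).mono hUD
  have hFc := hs.continuousOn.mono hUD
  rw [integral_add] at h1
  · have h2 : tau0 g = ∫ p in Disk, (1 / 2) * fderiv ℝ F p p := by
      unfold tau0
      apply setIntegral_congr_fun disk_closed.measurableSet
      rintro ⟨x, y⟩ hp
      have h3 : ((x, y) : ℝ × ℝ) = x • ((1:ℝ), (0:ℝ)) + y • ((0:ℝ), (1:ℝ)) := by simp
      have h4 : fderiv ℝ F (x, y) (x, y)
          = x * fderiv ℝ F (x, y) (1, 0) + y * fderiv ℝ F (x, y) (0, 1) := by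
        conv_lhs => arg 2; rw [h3]
        rw [map_add, map_smul, map_smul, smul_eq_mul, smul_eq_mul]
      simp only [h4, hd _ hp]
      ring
    rw [h2, kappaOf]
    linarith
  · apply ContinuousOn.integrableOn_compact disk_compact
    fun_prop
  · exact hFc.integrableOn_compact disk_compact

lemma prim_diffAt {g : SympD} {F : ℝ × ℝ → ℝ} (hF : IsPrimitive g F) {p : ℝ × ℝ}
    (hp : p ∈ Disk) : DifferentiableAt ℝ F p := by
  obtain ⟨⟨U, hU, hUD, hs⟩, -, -⟩ := hF
  exact (hs.contDiffAt (hU.mem_nhds (hUD hp))).differentiableAt (by simp)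

lemma prim_integrable {g : SympD} {F : ℝ × ℝ → ℝ} (hF : IsPrimitive g F) :
    IntegrableOn F Disk := by
  obtain ⟨⟨U, hU, hUD, hs⟩, -, -⟩ := hF
  exact (hs.continuousOn.mono hUD).integrableOn_compact disk_compact

lemma prim_comp_integrable {g h : SympD} {F : ℝ × ℝ → ℝ} (hF : IsPrimitive g F) :
    IntegrableOn (fun p => F (h.toFun p)) Disk := by
  obtain ⟨⟨U, hU, hUD, hs⟩, -, -⟩ := hF
  refine ContinuousOn.integrableOn_compact disk_compact ?_
  refine (hs.continuousOn.mono hUD).comp ?_ h.mapsTo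
  exact fun p hp => (h.diffAt hp).continuousAt.continuousWithinAt

lemma x0_bdry : ((1:ℝ), (0:ℝ)) ∈ Bdry := by simp [Bdry]

lemma x0_disk : ((1:ℝ), (0:ℝ)) ∈ Disk := by simp [Disk]

lemma prim_of_comp {g h gh : SympD} (hh : IsRel h) (hc : IsComp g h gh) {Fg Fgh : ℝ × ℝ → ℝ}
    (hFg : IsPrimitive g Fg) (hFgh : IsPrimitive gh Fgh) :
    IsPrimitive h (fun p => Fgh p - Fg (h.toFun p)) := by
  refine ⟨?_, ?_, ?_⟩
  · obtain ⟨⟨U, hU, hUD, hs⟩, -, -⟩ := hFg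
    obtain ⟨⟨V, hV, hVD, ht⟩, -, -⟩ := hFgh
    obtain ⟨W, hW, hWD, hw⟩ := h.smooth
    refine ⟨V ∩ (W ∩ h.toFun ⁻¹' U), hV.inter (hw.continuousOn.isOpen_inter_preimage hW hU),
      fun p hp => ⟨hVD hp, hWD hp, hUD (h.mapsTo hp)⟩, ?_⟩
    apply ContDiffOn.sub (ht.mono Set.inter_subset_left)
    exact hs.comp (hw.mono (fun p hp => hp.2.1)) (fun p hp => hp.2.2)
  · intro p hp v
    have h1 := prim_diffAt hFgh hp
    have h2 := prim_diffAt hFg (h.mapsTo hp)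
    have h3 := h2.hasFDerivAt.comp p (h.diffAt hp).hasFDerivAt
    have h4 := (h1.hasFDerivAt.sub h3).fderiv
    have h5 : fderiv ℝ (fun p => Fgh p - Fg (h.toFun p)) p v =
        fderiv ℝ Fgh p v - fderiv ℝ Fg (h.toFun p) (fderiv ℝ h.toFun p v) :=
      DFunLike.congr_fun h4 v
    rw [h5, hFgh.2.1 p hp, hFg.2.1 _ (h.mapsTo hp), comp_fderiv hc hp, hc p hp]
    ring
  · simp only [hh _ x0_bdry, hFgh.2.2, hFg.2.2, sub_zero]

lemma prim_rel_bdry {h : SympD} (hh : IsRel h) {F : ℝ × ℝ → ℝ} (hF : IsPrimitive h F)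
    (θ : ℝ) : F (Real.cos θ, Real.sin θ) = 0 := by
  have hb : ∀ t : ℝ, (Real.cos t, Real.sin t) ∈ Bdry := fun t => Real.cos_sq_add_sin_sq t
  have hD : ∀ t : ℝ, (Real.cos t, Real.sin t) ∈ Disk := fun t => le_of_eq (hb t)
  have hc : ∀ t : ℝ, HasDerivAt (fun t : ℝ => (Real.cos t, Real.sin t))
      (-Real.sin t, Real.cos t) t := fun t => (Real.hasDerivAt_cos t).prodMk (Real.hasDerivAt_sin t)
  have hder : ∀ t : ℝ, HasDerivAt (fun t : ℝ => F (Real.cos t, Real.sin t)) 0 t := by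
    intro t
    have h1 := (prim_diffAt hF (hD t)).hasFDerivAt.comp_hasDerivAt t (hc t)
    refine HasDerivAt.congr_deriv h1 ?_
    have h2 := (h.diffAt (hD t)).hasFDerivAt.comp_hasDerivAt t (hc t)
    have h3 : h.toFun ∘ (fun t : ℝ => (Real.cos t, Real.sin t)) =
        fun t : ℝ => (Real.cos t, Real.sin t) := funext fun s => hh _ (hb s)
    rw [h3] at h2
    rw [hF.2.1 _ (hD t), h2.unique (hc t), hh _ (hb t)]
    ring
  have := is_const_of_deriv_eq_zero (fun t => (hder t).differentiableAt)
    (fun t => (hder t).deriv) θ 0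
  simpa [hF.2.2] using this

lemma prim_rel_bdry' {h : SympD} (hh : IsRel h) {F : ℝ × ℝ → ℝ} (hF : IsPrimitive h F)
    {p : ℝ × ℝ} (hp : p ∈ Bdry) : F p = 0 := by
  obtain ⟨x, y⟩ := p
  have hxy : x ^ 2 + y ^ 2 = 1 := hp
  have hn : ‖(⟨x, y⟩ : ℂ)‖ = 1 := by
    rw [Complex.norm_def, Complex.normSq_mk, ← pow_two, ← pow_two, hxy, Real.sqrt_one]
  have h1 := Complex.norm_mul_cos_arg ⟨x, y⟩
  have h2 := Complex.norm_mul_sin_arg ⟨x, y⟩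
  rw [hn, one_mul] at h1 h2
  have := prim_rel_bdry hh hF (Complex.arg ⟨x, y⟩)
  rwa [h1, h2] at this

lemma prim_comp {h g hg : SympD} (hh : IsRel h) (hc : IsComp h g hg) {Fh Fg Fhg : ℝ × ℝ → ℝ}
    (hFh : IsPrimitive h Fh) (hFg : IsPrimitive g Fg) (hFhg : IsPrimitive hg Fhg)
    {p : ℝ × ℝ} (hp : p ∈ Disk) : Fhg p = Fh (g.toFun p) + Fg p := by
  have hd : ∀ p ∈ Disk, HasFDerivAt (𝕜 := ℝ) (fun p => Fhg p - (Fh (g.toFun p) + Fg p)) 0 p := by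
    intro p hp
    have h1 := (prim_diffAt hFhg hp).hasFDerivAt
    have h2 := (prim_diffAt hFh (g.mapsTo hp)).hasFDerivAt.comp p (g.diffAt hp).hasFDerivAt
    have h3 := (prim_diffAt hFg hp).hasFDerivAt
    refine HasFDerivAt.congr_fderiv (h1.sub (h2.add h3)) ?_
    refine ContinuousLinearMap.ext fun v => ?_
    change fderiv ℝ Fhg p v - (fderiv ℝ Fh (g.toFun p) (fderiv ℝ g.toFun p v) + fderiv ℝ Fg p v) = 0
    rw [hFhg.2.1 p hp, hFh.2.1 _ (g.mapsTo hp), hFg.2.1 p hp, comp_fderiv hc hp, hc p hp]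
    ring
  have := disk_convex.is_const_of_fderivWithin_eq_zero (𝕜 := ℝ)
    (fun q hq => (hd q hq).differentiableAt.differentiableWithinAt)
    (fun q hq => (hd q hq).hasFDerivWithinAt.fderivWithin (disk_uniqueDiff q hq)) hp x0_disk
  rw [hFhg.2.2, hFg.2.2, prim_rel_bdry' hh hFh (bdry_mapsTo g x0_bdry)] at this
  linarith

/-- with `τ' = τ₀ + κ`, for `g ∈ H` and `h ∈ H_rel`,
`τ'(g ∘ h) = τ'(g) + Cal(h)` and `τ'(h ∘ g) = τ'(g) + Cal(h)`, where the Calabi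
invariant `Cal` is the restriction of `τ₀` to `H_rel`. -/
theorem tau'_comp_rel (g h gh hg' : SympD) (hh : IsRel h)
    (hcomp : IsComp g h gh) (hcomp' : IsComp h g hg')
    (Fg Fgh Fhg : ℝ × ℝ → ℝ)
    (hFg : IsPrimitive g Fg) (hFgh : IsPrimitive gh Fgh) (hFhg : IsPrimitive hg' Fhg) :
    tau0 gh + kappaOf Fgh = (tau0 g + kappaOf Fg) + tau0 h ∧
      tau0 hg' + kappaOf Fhg = (tau0 g + kappaOf Fg) + tau0 h := by
  have hFh := prim_of_comp hh hcomp hFg hFgh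
  have hk : tau0 h = - ∫ p in Disk, (Fgh p - Fg (h.toFun p)) := by
    rw [← tau'_eq hFh, kappaOf]
    simp only [prim_rel_bdry hh hFh]
    simp
  constructor
  · rw [tau'_eq hFgh, tau'_eq hFg, hk,
      integral_sub (prim_integrable hFgh) (prim_comp_integrable hFg), integral_comp_symp h Fg]
    ring
  · have h1 : ∫ p in Disk, Fhg p =
        ∫ p in Disk, ((fun q => Fgh q - Fg (h.toFun q)) (g.toFun p) + Fg p) :=
      setIntegral_congr_fun disk_closed.measurableSet
        (fun p hp => prim_comp hh hcomp' hFh hFg hFhg hp)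
    rw [tau'_eq hFhg, tau'_eq hFg, hk, h1,
      integral_add (prim_comp_integrable hFh) (prim_integrable hFg),
      integral_comp_symp g (fun q => Fgh q - Fg (h.toFun q))]
    ring
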